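/- arXiv:1407.0809 — 2 statements merged into one kernel-verified Lean document; each statement's English description precedes it below -/
import Mathlib

section
/- Quadratic pencils of signed measures, pointwise part: Let (M, 𝒜) be a measurable space and μ₁, μ₂, μ₃ finite signed measures on it such that λ²μ₁ + 2λμ₂ + μ₃ ≥ 0 for every λ ∈ ℝ, i.e. (λ²μ₁ + 2λμ₂ + μ₃)(E) ≥ 0 for every E ∈ 𝒜 and λ ∈ ℝ. Then: (a) μ₁ ≥ 0 and μ₃ ≥ 0 (as signed measures); (b) for every E ∈ 𝒜, μ₁(E) = 0 implies |μ₂|(E) = 0, and μ₃(E) = 0 implies |μ₂|(E) = 0 (so |μ₂| is absolutely continuous with respect to both μ₁ and μ₃); (c) setting ν := |μ₁| + |μ₂| + |μ₃| and letting η_i denote the Radon–Nikodym density of μ_i with respect to ν (so that μ_i(E) = ∫_E η_i dν for every E ∈ 𝒜), one has η₂² ≤ η₁ η₃ ν-a.e. -/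
open MeasureTheory

noncomputable section

namespace Stmt17

/-- A real quadratic that is nonnegative everywhere has nonpositive reduced discriminant. -/
theorem sq_le_mul_of_forall_quadratic_nonneg {a b c : ℝ}
    (h : ∀ t : ℝ, 0 ≤ t ^ 2 * a + 2 * t * b + c) : b ^ 2 ≤ a * c := by
  have := discrim_le_zero (a := a) (b := 2 * b) (c := c) fun t => by linarith [h t]
  rw [discrim] at this
  linarith

/-- A real quadratic that is nonnegative everywhere has nonnegative leading coefficient. -/
theorem leadingCoeff_nonneg_of_forall_quadratic_nonneg {a b c : ℝ}
    (h : ∀ t : ℝ, 0 ≤ t ^ 2 * a + 2 * t * b + c) : 0 ≤ a := by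
  by_contra! ha
  have hc : 0 ≤ c := by simpa using h 0
  have hs : 0 ≤ c / -a := div_nonneg hc (by linarith)
  have hsa : c / -a * a = -c := by rw [div_neg, neg_mul, div_mul_cancel₀ c ha.ne]
  have h₁ := h (c / -a + 1)
  have h₂ := h (-(c / -a + 1))
  nlinarith [mul_nonneg hs hc]

/-- It suffices to check nonnegativity of a real quadratic at rational points. -/
theorem forall_quadratic_nonneg_of_forall_rat {a b c : ℝ}
    (h : ∀ q : ℚ, 0 ≤ (q : ℝ) ^ 2 * a + 2 * q * b + c) (t : ℝ) :
    0 ≤ t ^ 2 * a + 2 * t * b + c := by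
  have hclosed : IsClosed {t : ℝ | 0 ≤ t ^ 2 * a + 2 * t * b + c} :=
    isClosed_le continuous_const (by fun_prop)
  exact Rat.denseRange_cast.induction_on t hclosed h

/-- The total variation vanishes on a measurable set all of whose measurable subsets are null. -/
theorem totalVariation_eq_zero_of_forall_subset {M : Type*} [MeasurableSpace M]
    (μ : SignedMeasure M) {E : Set M} (hE : MeasurableSet E)
    (h : ∀ F ⊆ E, MeasurableSet F → μ F = 0) : μ.totalVariation E = 0 := by
  obtain ⟨i, hi, hi₂, hi₃, hpos, hneg⟩ := μ.toJordanDecomposition_spec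
  rw [SignedMeasure.totalVariation, Measure.add_apply, hpos, hneg,
    SignedMeasure.toMeasureOfZeroLE_apply _ _ _ hE,
    SignedMeasure.toMeasureOfLEZero_apply _ _ _ hE]
  have h₁ := h (i ∩ E) Set.inter_subset_right (hi.inter hE)
  have h₂ := h (iᶜ ∩ E) Set.inter_subset_right (hi.compl.inter hE)
  simp [h₁, h₂]

/-- Measurable subsets of a null set of a nonnegative signed measure are null. -/
theorem eq_zero_of_subset_of_eq_zero {M : Type*} [MeasurableSpace M]
    {μ : SignedMeasure M} (hμ : ∀ E, MeasurableSet E → 0 ≤ μ E) {E F : Set M}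
    (hE : MeasurableSet E) (hF : MeasurableSet F) (hFE : F ⊆ E) (h : μ E = 0) : μ F = 0 := by
  have := VectorMeasure.of_add_of_sdiff (v := μ) hF hE hFE
  linarith [hμ F hF, hμ (E \ F) (hE.diff hF)]

/-- **Quadratic pencils of signed measures, pointwise part.** If `λ²μ₁ + 2λμ₂ + μ₃ ≥ 0`
setwise for every `λ ∈ ℝ`, then `μ₁, μ₃ ≥ 0`, the total variation `|μ₂|` vanishes on every
measurable set where `μ₁` (or `μ₃`) vanishes, and the Radon–Nikodym densities `ηᵢ` of the
`μᵢ` with respect to `ν := |μ₁| + |μ₂| + |μ₃|` satisfy `η₂² ≤ η₁ η₃` `ν`-a.e. -/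
theorem quadratic_pencil_of_signed_measures_pointwise
    {M : Type*} [MeasurableSpace M] (μ₁ μ₂ μ₃ : SignedMeasure M)
    (hpos : ∀ (lam : ℝ) (E : Set M), MeasurableSet E →
      0 ≤ lam ^ 2 * μ₁ E + 2 * lam * μ₂ E + μ₃ E) :
    (∀ E : Set M, MeasurableSet E → 0 ≤ μ₁ E) ∧
    (∀ E : Set M, MeasurableSet E → 0 ≤ μ₃ E) ∧
    (∀ E : Set M, MeasurableSet E → μ₁ E = 0 → μ₂.totalVariation E = 0) ∧
    (∀ E : Set M, MeasurableSet E → μ₃ E = 0 → μ₂.totalVariation E = 0) ∧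
    (∀ η₁ η₂ η₃ : M → ℝ,
      Integrable η₁ (μ₁.totalVariation + μ₂.totalVariation + μ₃.totalVariation) →
      Integrable η₂ (μ₁.totalVariation + μ₂.totalVariation + μ₃.totalVariation) →
      Integrable η₃ (μ₁.totalVariation + μ₂.totalVariation + μ₃.totalVariation) →
      (∀ E : Set M, MeasurableSet E →
        μ₁ E = ∫ x in E, η₁ x ∂(μ₁.totalVariation + μ₂.totalVariation + μ₃.totalVariation)) →
      (∀ E : Set M, MeasurableSet E →
        μ₂ E = ∫ x in E, η₂ x ∂(μ₁.totalVariation + μ₂.totalVariation + μ₃.totalVariation)) →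
      (∀ E : Set M, MeasurableSet E →
        μ₃ E = ∫ x in E, η₃ x ∂(μ₁.totalVariation + μ₂.totalVariation + μ₃.totalVariation)) →
      ∀ᵐ x ∂(μ₁.totalVariation + μ₂.totalVariation + μ₃.totalVariation),
        η₂ x ^ 2 ≤ η₁ x * η₃ x) := by
  have h₁ : ∀ E : Set M, MeasurableSet E → 0 ≤ μ₁ E := fun E hE =>
    leadingCoeff_nonneg_of_forall_quadratic_nonneg fun t => hpos t E hE
  have h₃ : ∀ E : Set M, MeasurableSet E → 0 ≤ μ₃ E := fun E hE => by
    simpa using hpos 0 E hE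
  have hsq : ∀ E : Set M, MeasurableSet E → μ₂ E ^ 2 ≤ μ₁ E * μ₃ E := fun E hE =>
    sq_le_mul_of_forall_quadratic_nonneg fun t => hpos t E hE
  refine ⟨h₁, h₃, fun E hE h => ?_, fun E hE h => ?_, ?_⟩
  · refine totalVariation_eq_zero_of_forall_subset μ₂ hE fun F hFE hF => ?_
    have := hsq F hF
    rw [eq_zero_of_subset_of_eq_zero h₁ hE hF hFE h, zero_mul] at this
    exact pow_eq_zero_iff two_ne_zero |>.mp (this.antisymm (sq_nonneg _))
  · refine totalVariation_eq_zero_of_forall_subset μ₂ hE fun F hFE hF => ?_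
    have := hsq F hF
    rw [eq_zero_of_subset_of_eq_zero h₃ hE hF hFE h, mul_zero] at this
    exact pow_eq_zero_iff two_ne_zero |>.mp (this.antisymm (sq_nonneg _))
  · intro η₁ η₂ η₃ i₁ i₂ i₃ e₁ e₂ e₃
    have key : ∀ᵐ x ∂(μ₁.totalVariation + μ₂.totalVariation + μ₃.totalVariation),
        ∀ q : ℚ, 0 ≤ (q : ℝ) ^ 2 * η₁ x + 2 * q * η₂ x + η₃ x := by
      refine ae_all_iff.mpr fun q => ?_
      have j₁ := i₁.const_mul ((q : ℝ) ^ 2)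
      have j₂ := i₂.const_mul (2 * (q : ℝ))
      have j₁₂ : Integrable (fun x => (q : ℝ) ^ 2 * η₁ x + 2 * q * η₂ x)
          (μ₁.totalVariation + μ₂.totalVariation + μ₃.totalVariation) := j₁.add j₂
      refine ae_nonneg_of_forall_setIntegral_nonneg (j₁₂.add i₃) fun E hE _ => ?_
      have hint : ∫ x in E, ((q : ℝ) ^ 2 * η₁ x + 2 * q * η₂ x + η₃ x)
          ∂(μ₁.totalVariation + μ₂.totalVariation + μ₃.totalVariation) =
          (q : ℝ) ^ 2 * μ₁ E + 2 * q * μ₂ E + μ₃ E := by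
        rw [integral_add j₁₂.integrableOn i₃.integrableOn,
          integral_add j₁.integrableOn j₂.integrableOn, integral_const_mul,
          integral_const_mul, e₁ E hE, e₂ E hE, e₃ E hE]
      exact (hpos q E hE).trans_eq hint.symm
    filter_upwards [key] with x hx
    exact sq_le_mul_of_forall_quadratic_nonneg (forall_quadratic_nonneg_of_forall_rat hx)

end Stmt17
end
end

section
/- Quadratic pencils of signed measures, total-variation and Lebesgue-decomposition part: Let (M, 𝒜) be a measurable space and μ₁, μ₂, μ₃ finite signed measures on it such that λ²μ₁ + 2λμ₂ + μ₃ ≥ 0 for every λ ∈ ℝ, i.e. (λ²μ₁ + 2λμ₂ + μ₃)(E) ≥ 0 for every E ∈ 𝒜 and λ ∈ ℝ. Then ‖μ₂‖_TV ≤ √(‖μ₁‖_TV ‖μ₃‖_TV). Moreover, if m is a σ-finite nonnegative measure on (M, 𝒜) and μ_i = ρ_i·m + μ_iˢ (i = 1, 2, 3) are the Lebesgue decompositions of the μ_i with respect to m, with ρ_i ∈ L¹(m) and μ_iˢ singular with respect to m, then μ₁ˢ ≥ 0, μ₃ˢ ≥ 0 and ρ₂² ≤ ρ₁ ρ₃ m-a.e.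 -/
open MeasureTheory

noncomputable section

namespace Stmt18

/-- The total mass of a signed measure is the difference of its values on the two halves of a
Hahn decomposition. -/
lemma exists_totalVariation_univ_eq {M : Type*} [MeasurableSpace M] (μ : SignedMeasure M) :
    ∃ S : Set M, MeasurableSet S ∧ (μ.totalVariation Set.univ).toReal = μ Sᶜ - μ S := by
  obtain ⟨S, hS, hpos, hneg⟩ := μ.toJordanDecomposition.mutuallySingular
  refine ⟨S, hS, ?_⟩
  have hp : μ.toJordanDecomposition.posPart.real S = 0 := by simp [Measure.real, hpos]
  have hn : μ.toJordanDecomposition.negPart.real Sᶜ = 0 := by simp [Measure.real, hneg]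
  rw [μ.apply_eq_posPart_real_sub_negPart_real hS,
    μ.apply_eq_posPart_real_sub_negPart_real hS.compl, hp, hn]
  change (μ.toJordanDecomposition.posPart + μ.toJordanDecomposition.negPart).real Set.univ = _
  rw [measureReal_add_apply, ← measureReal_add_measureReal_compl hS,
    ← measureReal_add_measureReal_compl (μ := μ.toJordanDecomposition.negPart) hS, hp, hn]
  ring

lemma apply_univ_le_totalVariation {M : Type*} [MeasurableSpace M] (μ : SignedMeasure M) :
    μ Set.univ ≤ (μ.totalVariation Set.univ).toReal := by
  rw [μ.apply_eq_posPart_real_sub_negPart_real MeasurableSet.univ]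
  change _ ≤ (μ.toJordanDecomposition.posPart + μ.toJordanDecomposition.negPart).real Set.univ
  rw [measureReal_add_apply]
  linarith [measureReal_nonneg (μ := μ.toJordanDecomposition.negPart) (s := Set.univ)]

lemma sq_le_mul_of_forall_quadratic_nonneg {a b c : ℝ}
    (h : ∀ t : ℝ, 0 ≤ t ^ 2 * a + 2 * t * b + c) : b ^ 2 ≤ a * c := by
  have := discrim_le_zero (a := a) (b := 2 * b) (c := c) fun t => by linarith [h t]
  rw [discrim] at this
  linarith

lemma leadingCoeff_nonneg_of_forall_quadratic_nonneg {a b c : ℝ}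
    (h : ∀ t : ℝ, 0 ≤ t ^ 2 * a + 2 * t * b + c) : 0 ≤ a := by
  have hc : 0 ≤ c := by simpa using h 0
  have h1 := h 1
  have hsq := sq_le_mul_of_forall_quadratic_nonneg h
  by_contra! ha
  have hb : b = 0 := by nlinarith [mul_nonneg hc (neg_nonneg.2 ha.le)]
  have hc' : c = 0 := by nlinarith [sq_nonneg b]
  linarith

/-- If `T` is an `m`-conull measurable set that is null for `σ`, then restricting `μ = ρ·m + σ` to
`T` gives `ρ·m`, and restricting it to `Tᶜ` gives `σ`. -/
lemma apply_inter_eq_setIntegral_and_apply_diff_eq {M : Type*} [MeasurableSpace M]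
    {m : Measure M} {ρ : M → ℝ} {μ σ : SignedMeasure M} {T : Set M} (hT : MeasurableSet T)
    (hσ : σ.totalVariation T = 0) (hm : m Tᶜ = 0)
    (h : ∀ E : Set M, MeasurableSet E → μ E = (∫ x in E, ρ x ∂m) + σ E)
    {E : Set M} (hE : MeasurableSet E) :
    μ (E ∩ T) = ∫ x in E, ρ x ∂m ∧ μ (E \ T) = σ E := by
  have hσ0 : σ (E ∩ T) = 0 :=
    σ.null_of_totalVariation_zero (measure_mono_null Set.inter_subset_right hσ)
  have hm0 : m (E \ T) = 0 := measure_mono_null (fun _ hx => hx.2) hm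
  constructor
  · rw [h _ (hE.inter hT), hσ0, add_zero]
    refine setIntegral_congr_set (ae_eq_set.2 ⟨?_, ?_⟩)
    · rw [Set.sdiff_eq_empty.2 Set.inter_subset_left, measure_empty]
    · rwa [Set.sdiff_self_inter]
  · rw [h _ (hE.diff hT), Measure.restrict_eq_zero.2 hm0, integral_zero_measure, zero_add]
    have := VectorMeasure.of_add_of_sdiff (v := σ) (hE.inter hT) hE Set.inter_subset_left
    rwa [hσ0, zero_add, Set.sdiff_self_inter] at this

/-- **Quadratic pencils of signed measures: total variation and Lebesgue decomposition.**
If `λ²μ₁ + 2λμ₂ + μ₃ ≥ 0` setwise for every `λ ∈ ℝ`, then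
`‖μ₂‖_TV ≤ √(‖μ₁‖_TV ‖μ₃‖_TV)`; moreover for any Lebesgue decompositions
`μᵢ = ρᵢ·m + σᵢ` with respect to a σ-finite nonnegative measure `m` (`ρᵢ ∈ L¹(m)`, `σᵢ`
singular with respect to `m`), the singular parts `σ₁, σ₃` are nonnegative and
`ρ₂² ≤ ρ₁ ρ₃` holds `m`-a.e. -/
theorem quadratic_pencil_of_signed_measures_tv_and_lebesgue
    {M : Type*} [MeasurableSpace M] (μ₁ μ₂ μ₃ : SignedMeasure M)
    (hpos : ∀ (lam : ℝ) (E : Set M), MeasurableSet E →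
      0 ≤ lam ^ 2 * μ₁ E + 2 * lam * μ₂ E + μ₃ E) :
    ((μ₂.totalVariation Set.univ).toReal ≤
      Real.sqrt ((μ₁.totalVariation Set.univ).toReal *
        (μ₃.totalVariation Set.univ).toReal)) ∧
    (∀ (m : Measure M) [SigmaFinite m] (ρ₁ ρ₂ ρ₃ : M → ℝ) (σ₁ σ₂ σ₃ : SignedMeasure M),
      Integrable ρ₁ m → Integrable ρ₂ m → Integrable ρ₃ m →
      σ₁.totalVariation ⟂ₘ m → σ₂.totalVariation ⟂ₘ m → σ₃.totalVariation ⟂ₘ m →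
      (∀ E : Set M, MeasurableSet E → μ₁ E = (∫ x in E, ρ₁ x ∂m) + σ₁ E) →
      (∀ E : Set M, MeasurableSet E → μ₂ E = (∫ x in E, ρ₂ x ∂m) + σ₂ E) →
      (∀ E : Set M, MeasurableSet E → μ₃ E = (∫ x in E, ρ₃ x ∂m) + σ₃ E) →
      (∀ E : Set M, MeasurableSet E → 0 ≤ σ₁ E) ∧
      (∀ E : Set M, MeasurableSet E → 0 ≤ σ₃ E) ∧
      (∀ᵐ x ∂m, ρ₂ x ^ 2 ≤ ρ₁ x * ρ₃ x)) := by
  constructor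
  · obtain ⟨S, hS, hSeq⟩ := exists_totalVariation_univ_eq μ₂
    have hadd (μ : SignedMeasure M) : μ S + μ Sᶜ = μ Set.univ := by
      rw [← VectorMeasure.of_union disjoint_compl_right hS hS.compl, Set.union_compl_self]
    refine Real.le_sqrt_of_sq_le (sq_le_mul_of_forall_quadratic_nonneg fun t => ?_)
    have h₁ := hpos t _ hS.compl
    have h₂ := hpos (-t) _ hS
    have hle : t ^ 2 * μ₁ Set.univ ≤ t ^ 2 * (μ₁.totalVariation Set.univ).toReal :=
      mul_le_mul_of_nonneg_left (apply_univ_le_totalVariation μ₁) (sq_nonneg t)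
    have hle₃ := apply_univ_le_totalVariation μ₃
    rw [← hadd μ₁] at hle
    rw [← hadd μ₃] at hle₃
    rw [hSeq]
    linarith
  · intro m _ ρ₁ ρ₂ ρ₃ σ₁ σ₂ σ₃ hρ₁ hρ₂ hρ₃ hσ₁ hσ₂ hσ₃ hμ₁ hμ₂ hμ₃
    obtain ⟨T, hT, hTσ, hTm⟩ := (hσ₁.add_left hσ₂).add_left hσ₃
    simp only [Measure.coe_add, Pi.add_apply, add_eq_zero] at hTσ
    obtain ⟨⟨hT₁, hT₂⟩, hT₃⟩ := hTσ
    have k₁ {E : Set M} (hE : MeasurableSet E) :=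
      apply_inter_eq_setIntegral_and_apply_diff_eq hT hT₁ hTm hμ₁ hE
    have k₂ {E : Set M} (hE : MeasurableSet E) :=
      apply_inter_eq_setIntegral_and_apply_diff_eq hT hT₂ hTm hμ₂ hE
    have k₃ {E : Set M} (hE : MeasurableSet E) :=
      apply_inter_eq_setIntegral_and_apply_diff_eq hT hT₃ hTm hμ₃ hE
    refine ⟨fun E hE => ?_, fun E hE => ?_, ?_⟩
    · rw [← (k₁ hE).2]
      exact leadingCoeff_nonneg_of_forall_quadratic_nonneg fun t => hpos t _ (hE.diff hT)
    · rw [← (k₃ hE).2]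
      simpa using hpos 0 _ (hE.diff hT)
    · have hq : ∀ᵐ x ∂m, ∀ q : ℚ, 0 ≤ (q : ℝ) ^ 2 * ρ₁ x + 2 * q * ρ₂ x + ρ₃ x := by
        refine ae_all_iff.2 fun q => ?_
        have i₁ := hρ₁.const_mul ((q : ℝ) ^ 2)
        have i₂ := hρ₂.const_mul (2 * (q : ℝ))
        have i₁₂ : Integrable (fun x => (q : ℝ) ^ 2 * ρ₁ x + 2 * (q : ℝ) * ρ₂ x) m := i₁.add i₂
        refine ae_nonneg_of_forall_setIntegral_nonneg (i₁₂.add hρ₃) fun E hE _ => ?_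
        have := hpos q _ (hE.inter hT)
        rw [(k₁ hE).1, (k₂ hE).1, (k₃ hE).1, ← integral_const_mul, ← integral_const_mul,
          ← integral_add i₁.integrableOn i₂.integrableOn,
          ← integral_add i₁₂.integrableOn hρ₃.integrableOn] at this
        exact this
      filter_upwards [hq] with x hx
      refine sq_le_mul_of_forall_quadratic_nonneg fun t => ?_
      exact Rat.denseRange_cast.induction_on t
        (isClosed_le continuous_const (by fun_prop)) hx

end Stmt18
end
end
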